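/- Let G be a finite 2-group and g ∈ G such that ℚ(g) is not a cyclotomic field (i.e. ℚ(g) ≠ ℚ(ζ_m) for every positive integer m). Then for every subfield K of ℚ(g) there exists an irreducible complex character χ of G such that K = ℚ(χ(g)), the subfield of ℂ generated by the single value χ(g). -/

import Mathlib

open CategoryTheory Module Pointwise
open scoped MatrixGroups

/-- The set of all values `χ(g)` of irreducible complex characters `χ` of `G`. -/
noncomputable def charValues (G : Type) [Group G] : Set ℂ :=
  {z : ℂ | ∃ V : FDRep ℂ G, Simple V ∧ ∃ g : G, V.character g = z}

/-- `ℚ(G)`, the field of character values of `G`, as a subfield of `ℂ`. -/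
noncomputable def charField (G : Type) [Group G] : Subfield ℂ :=
  Subfield.closure (charValues G)

/-- `ℤ[G]`, the subring of `ℂ` generated by the character values of `G`. -/
noncomputable def charRing (G : Type) [Group G] : Subring ℂ :=
  Subring.closure (charValues G)

/-- The ring of integers of a subfield `K` of `ℂ`, i.e. the elements of `K` integral
over `ℤ`, as a subring of `ℂ`. -/
noncomputable def ringOfIntIn (K : Subfield ℂ) : Subring ℂ :=
  (integralClosure ℤ ℂ).toSubring ⊓ K.toSubring

/-- The additive quotient group `ℤ_{ℚ(G)}/ℤ[G]`. -/
noncomputable def charQuot (G : Type) [Group G] :=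
  ↥((ringOfIntIn (charField G)).toAddSubgroup) ⧸
    ((charRing G).toAddSubgroup.addSubgroupOf (ringOfIntIn (charField G)).toAddSubgroup)

noncomputable instance (G : Type) [Group G] : AddCommGroup (charQuot G) := by
  unfold charQuot; infer_instance

/-- The `m`-th cyclotomic field `ℚ(ζ_m)`, as the subfield of `ℂ` generated by the
`m`-th roots of unity. -/
noncomputable def cycField (m : ℕ) : Subfield ℂ :=
  Subfield.closure {z : ℂ | z ^ m = 1}

/-- The set of values `χ(g)` at a fixed `g` of irreducible complex characters `χ` of `G`. -/
noncomputable def charValuesAt {G : Type} [Group G] (g : G) : Set ℂ :=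
  {z : ℂ | ∃ V : FDRep ℂ G, Simple V ∧ V.character g = z}

/-- `ℚ(g)`, the subfield of `ℂ` generated by one column of the character table. -/
noncomputable def charFieldAt {G : Type} [Group G] (g : G) : Subfield ℂ :=
  Subfield.closure (charValuesAt g)

/-- `ℤ[g]`, the subring of `ℂ` generated by one column of the character table. -/
noncomputable def charRingAt {G : Type} [Group G] (g : G) : Subring ℂ :=
  Subring.closure (charValuesAt g)

lemma cycField_le_iff_mem {m : ℕ} [NeZero m] {ζ : ℂ} (hζ : IsPrimitiveRoot ζ m) (F : Subfield ℂ) :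
    cycField m ≤ F ↔ ζ ∈ F := by
  refine ⟨fun h => h (Subfield.subset_closure hζ.pow_eq_one), fun h => ?_⟩
  refine Subfield.closure_le.2 fun z hz => ?_
  obtain ⟨i, -, rfl⟩ := hζ.eq_pow_of_pow_eq_one hz
  exact pow_mem h i

lemma cycField_mono {m n : ℕ} (h : m ∣ n) : cycField m ≤ cycField n := by
  refine Subfield.closure_mono fun z (hz : z ^ m = 1) => ?_
  obtain ⟨k, rfl⟩ := h
  simp [pow_mul, hz]

/-- A quadratic extension of subfields, described by elements. -/
lemma exists_add_mul_of_mem_closure_insert {F : Subfield ℂ} {x y : ℂ} (hx : x ^ 2 ∈ F)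
    (hy : y ∈ Subfield.closure (insert x (F : Set ℂ))) :
    ∃ a ∈ F, ∃ b ∈ F, y = a + b * x := by
  induction hy using Subfield.closure_induction with
  | mem y hy =>
    rcases hy with rfl | hy
    · exact ⟨0, zero_mem F, 1, one_mem F, by ring⟩
    · exact ⟨y, hy, 0, zero_mem F, by ring⟩
  | one => exact ⟨1, one_mem F, 0, zero_mem F, by ring⟩
  | add y z _ _ hy hz =>
    obtain ⟨a, ha, b, hb, rfl⟩ := hy
    obtain ⟨c, hc, d, hd, rfl⟩ := hz
    exact ⟨a + c, add_mem ha hc, b + d, add_mem hb hd, by ring⟩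
  | neg y _ hy =>
    obtain ⟨a, ha, b, hb, rfl⟩ := hy
    exact ⟨-a, neg_mem ha, -b, neg_mem hb, by ring⟩
  | inv y _ hy =>
    obtain ⟨a, ha, b, hb, rfl⟩ := hy
    have hn : a ^ 2 - b ^ 2 * x ^ 2 ∈ F :=
      sub_mem (pow_mem ha 2) (mul_mem (pow_mem hb 2) hx)
    by_cases h1 : a + b * x = 0
    · exact ⟨0, zero_mem F, 0, zero_mem F, by simp [h1]⟩
    by_cases h2 : a - b * x = 0
    · refine ⟨(2 * a)⁻¹, inv_mem (mul_mem (ofNat_mem F 2) ha), 0, zero_mem F, ?_⟩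
      rw [show a + b * x = 2 * a by linear_combination -h2]
      ring
    · refine ⟨a / (a ^ 2 - b ^ 2 * x ^ 2), div_mem ha hn,
        -b / (a ^ 2 - b ^ 2 * x ^ 2), div_mem (neg_mem hb) hn, ?_⟩
      have h3 : a ^ 2 - b ^ 2 * x ^ 2 ≠ 0 := by
        rw [show a ^ 2 - b ^ 2 * x ^ 2 = (a + b * x) * (a - b * x) by ring]
        exact mul_ne_zero h1 h2
      field_simp
      ring
  | mul y z _ _ hy hz =>
    obtain ⟨a, ha, b, hb, rfl⟩ := hy
    obtain ⟨c, hc, d, hd, rfl⟩ := hz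
    exact ⟨a * c + b * d * x ^ 2, add_mem (mul_mem ha hc) (mul_mem (mul_mem hb hd) hx),
      a * d + b * c, add_mem (mul_mem ha hd) (mul_mem hb hc), by ring⟩

/-- There is no field strictly between `F` and `F(x)` when `x ^ 2 ∈ F`. -/
lemma le_or_mem_of_le_closure_insert {F K : Subfield ℂ} {x : ℂ} (hx : x ^ 2 ∈ F) (hFK : F ≤ K)
    (hK : K ≤ Subfield.closure (insert x (F : Set ℂ))) : K ≤ F ∨ x ∈ K := by
  refine or_iff_not_imp_right.2 fun hxK y hy => ?_
  obtain ⟨a, ha, b, hb, rfl⟩ := exists_add_mul_of_mem_closure_insert hx (hK hy)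
  have hb0 : b = 0 := by
    by_contra hb0
    refine hxK ?_
    have := div_mem (sub_mem hy (hFK ha)) (hFK hb)
    rwa [add_sub_cancel_left, mul_div_cancel_left₀ _ hb0] at this
  simpa [hb0] using ha

/-- The inclusion order on subfields of a field without `i` can be tested after adjoining `i`. -/
lemma le_of_le_closure_insert_I {L K₁ K₂ : Subfield ℂ} (hL : Complex.I ∉ L) (h₁ : K₁ ≤ L)
    (h₂ : K₂ ≤ L) (h : K₁ ≤ Subfield.closure (insert Complex.I (K₂ : Set ℂ))) : K₁ ≤ K₂ := by
  intro y hy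
  obtain ⟨a, ha, b, hb, rfl⟩ := exists_add_mul_of_mem_closure_insert (F := K₂)
    (by simp) (h hy)
  have hb0 : b = 0 := by
    by_contra hb0
    refine hL ?_
    have := div_mem (sub_mem (h₁ hy) (h₂ ha)) (h₂ hb)
    rwa [add_sub_cancel_left, mul_div_cancel_left₀ _ hb0] at this
  simpa [hb0] using ha

lemma mem_of_pow_four_eq_one {F : Subfield ℂ} (hI : Complex.I ∈ F) {x : ℂ} (hx : x ^ 4 = 1) :
    x ∈ F := by
  obtain ⟨i, -, rfl⟩ := Complex.isPrimitiveRoot_I.eq_pow_of_pow_eq_one hx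
  exact pow_mem hI i

lemma isPGroup_two_units_zmod {n : ℕ} (hn : n ≠ 0) : IsPGroup 2 (ZMod (2 ^ n))ˣ := by
  refine IsPGroup.of_card (n := n - 1) ?_
  rw [Nat.card_eq_fintype_card, ZMod.card_units_eq_totient,
    Nat.totient_prime_pow Nat.prime_two (Nat.pos_of_ne_zero hn)]
  simp

open IntermediateField in
/-- A nontrivial Galois group of a `2`-power cyclotomic extension of a field containing `i`
contains the automorphism `ζ ↦ -ζ`. -/
lemma exists_algEquiv_map_eq_neg {n : ℕ} {F : Subfield ℂ} (hI : Complex.I ∈ F) {ζ : ℂ}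
    (hζ : IsPrimitiveRoot ζ (2 ^ n)) (hF : ζ ∉ F) :
    ∃ σ : F⟮ζ⟯ ≃ₐ[F] F⟮ζ⟯, σ (AdjoinSimple.gen F ζ) = - AdjoinSimple.gen F ζ := by
  have hn : 2 ≤ n := by
    by_contra! hn
    refine hF (mem_of_pow_four_eq_one hI ?_)
    rw [hζ.pow_eq_one_iff_dvd]
    exact pow_dvd_pow 2 (show n ≤ 2 by omega)
  obtain ⟨m, rfl⟩ := Nat.exists_eq_add_of_le hn
  have hζint : IsIntegral F ζ := ⟨.X ^ (2 ^ (2 + m)) - 1,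
    Polynomial.monic_X_pow_sub_C 1 (by positivity), by simp [hζ.pow_eq_one]⟩
  have hcyc : IsCyclotomicExtension {2 ^ (2 + m)} F F⟮ζ⟯ := by
    change IsCyclotomicExtension _ F F⟮ζ⟯.toSubalgebra
    rw [adjoin_simple_toSubalgebra_of_isAlgebraic hζint.isAlgebraic]
    exact hζ.adjoin_isCyclotomicExtension F
  have := IsCyclotomicExtension.isGalois {2 ^ (2 + m)} F F⟮ζ⟯
  have := IsCyclotomicExtension.finiteDimensional {2 ^ (2 + m)} F F⟮ζ⟯
  set z := AdjoinSimple.gen F ζ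
  have hzζ : (z : ℂ) = ζ := AdjoinSimple.coe_gen F ζ
  have hzp : IsPrimitiveRoot z (2 ^ (2 + m)) :=
    IsPrimitiveRoot.coe_submonoidClass_iff.1 (by rwa [hzζ])
  have hz0 : z ≠ 0 := hzp.ne_zero (by positivity)
  have hp : IsPGroup 2 (F⟮ζ⟯ ≃ₐ[F] F⟮ζ⟯) :=
    (isPGroup_two_units_zmod (by omega)).of_injective _ (hzp.autToPow_injective F)
  have hcard : 2 ∣ Nat.card (F⟮ζ⟯ ≃ₐ[F] F⟮ζ⟯) := by
    obtain ⟨k, hk⟩ := IsPGroup.iff_card.1 hp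
    rcases Nat.eq_zero_or_pos k with rfl | hk0
    · rw [IsGalois.card_aut_eq_finrank, pow_zero, finrank_adjoin_simple_eq_one_iff,
        IntermediateField.mem_bot] at hk
      obtain ⟨x, rfl⟩ := hk
      exact absurd x.2 hF
    · rw [hk]
      exact dvd_pow_self 2 hk0.ne'
  obtain ⟨σ, hσ⟩ := exists_prime_orderOf_dvd_card' 2 hcard
  refine ⟨σ, ?_⟩
  have hσz : σ z ≠ z := fun h => by
    have h1 : σ = 1 := by
      refine AlgEquiv.coe_toAlgHom_injective
        (algHom_ext_of_eq_adjoin F (S := F⟮ζ⟯) rfl fun x hx => ?_)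
      obtain rfl : x = ζ := hx
      exact h
    simp [h1] at hσ
  have hσσ : σ (σ z) = z := by
    have := pow_orderOf_eq_one σ
    rw [hσ, pow_two] at this
    exact DFunLike.congr_fun this z
  have hfix : σ (z ^ 2 ^ m) = z ^ 2 ^ m := by
    have h4 : ζ ^ 2 ^ m ∈ F := mem_of_pow_four_eq_one hI (by
      rw [← pow_mul, mul_comm, show 4 = 2 ^ 2 from rfl, ← pow_add, hζ.pow_eq_one])
    have : z ^ 2 ^ m = algebraMap F F⟮ζ⟯ ⟨_, h4⟩ := Subtype.ext (by simp [hzζ]; rfl)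
    rw [this, σ.commutes]
  have hw : (σ z / z) ^ 2 ^ m = 1 := by
    rw [div_pow, ← map_pow, hfix, div_self (pow_ne_zero _ hz0)]
  have h4p : IsPrimitiveRoot (z ^ 4) (2 ^ m) :=
    hzp.pow (by positivity) (by rw [pow_add]; norm_num)
  obtain ⟨c, -, hc⟩ := h4p.eq_pow_of_pow_eq_one hw
  have hσc : σ z = z ^ (4 * c) * z := by
    rw [pow_mul, hc, div_mul_cancel₀ _ hz0]
  have h1 : z ^ (8 * c * (2 * c + 1)) = 1 := by
    have h2 := hσσ
    rw [hσc, map_mul, map_pow, hσc] at h2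
    have h3 : z ^ (8 * c * (2 * c + 1)) * z = 1 * z := by
      rw [one_mul]; nth_rw 3 [← h2]; ring
    exact mul_right_cancel₀ hz0 h3
  have hdvd : 2 ^ (2 + m) ∣ 8 * c := by
    refine Nat.Coprime.dvd_of_dvd_mul_right (Nat.Coprime.pow_left _ ?_) (hzp.dvd_of_pow_eq_one _ h1)
    simp
  have hsq : (z ^ (4 * c)) ^ 2 = 1 := by
    rw [← pow_mul, show 4 * c * 2 = 8 * c by ring]
    exact (hzp.pow_eq_one_iff_dvd _).2 hdvd
  rcases eq_or_eq_neg_of_sq_eq_sq (z ^ (4 * c)) 1 (by rwa [one_pow]) with h | h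
  · exact absurd (by rw [hσc, h, one_mul]) hσz
  · rw [hσc, h, neg_one_mul]

open IntermediateField in
lemma mem_or_le_cycField {n : ℕ} {F : Subfield ℂ} (hI : Complex.I ∈ F) {ζ : ℂ}
    (hζ : IsPrimitiveRoot ζ (2 ^ (n + 1))) (hF : F ≤ cycField (2 ^ (n + 1))) :
    ζ ∈ F ∨ F ≤ cycField (2 ^ n) := by
  refine or_iff_not_imp_left.2 fun hζF => ?_
  obtain ⟨σ, hσ⟩ := exists_algEquiv_map_eq_neg hI hζ hζF
  have hζ2 : IsPrimitiveRoot (ζ ^ 2) (2 ^ n) := hζ.pow (by positivity) (by ring)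
  have hζ2mem : ζ ^ 2 ∈ cycField (2 ^ n) := Subfield.subset_closure hζ2.pow_eq_one
  have hfix : ∀ x ∈ cycField (2 ^ n), ∃ e : F⟮ζ⟯, σ e = e ∧ (e : ℂ) = x := by
    have h : cycField (2 ^ n) ≤ (RingHom.eqLocusField (σ : F⟮ζ⟯ →+* F⟮ζ⟯) (RingHom.id _)).map
        (algebraMap F⟮ζ⟯ ℂ) := by
      rw [cycField_le_iff_mem hζ2]
      refine ⟨AdjoinSimple.gen F ζ ^ 2, ?_, by simp⟩
      change σ _ = _
      rw [map_pow, hσ, neg_sq]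
      rfl
    exact fun x hx => h hx
  intro y hy
  obtain ⟨a, ha, b, hb, hab⟩ := exists_add_mul_of_mem_closure_insert hζ2mem
    (y := y) (by
      refine (cycField_le_iff_mem hζ _).2 (Subfield.subset_closure (Set.mem_insert _ _)) (hF hy))
  obtain ⟨a', ha', rfl⟩ := hfix a ha
  obtain ⟨b', hb', rfl⟩ := hfix b hb
  have h1 : algebraMap F F⟮ζ⟯ ⟨y, hy⟩ = a' + b' * AdjoinSimple.gen F ζ :=
    Subtype.ext (by simpa using! hab)
  have h2 := congrArg σ h1
  rw [σ.commutes, map_add, map_mul, ha', hb', hσ, h1] at h2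
  have h3 : b' * AdjoinSimple.gen F ζ = 0 := by linear_combination h2 / 2
  have h4 : (b' : ℂ) * ζ = 0 := by simpa using congrArg (Subtype.val) h3
  rw [hab, h4, add_zero]
  exact ha

lemma exists_eq_cycField {n : ℕ} {F : Subfield ℂ} (hI : Complex.I ∈ F)
    (hF : F ≤ cycField (2 ^ n)) : ∃ k, F = cycField (2 ^ k) := by
  induction n with
  | zero =>
    exact ⟨0, le_antisymm hF ((cycField_le_iff_mem (by simp) F).2
      (one_mem F))⟩
  | succ n ih =>
    have hζ := Complex.isPrimitiveRoot_exp (2 ^ (n + 1)) (by positivity)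
    rcases mem_or_le_cycField hI hζ hF with h | h
    · exact ⟨n + 1, le_antisymm hF ((cycField_le_iff_mem hζ F).2 h)⟩
    · exact ih h

/-- The subfields of a non-cyclotomic subfield of `ℚ(ζ_{2^n})` form a chain. -/
lemma subfields_total_of_not_cyclotomic {n : ℕ} (hn : 2 ≤ n) {L : Subfield ℂ}
    (hL : L ≤ cycField (2 ^ n)) (hnc : ¬ ∃ m : ℕ, 0 < m ∧ L = cycField m)
    {K₁ K₂ : Subfield ℂ} (h₁ : K₁ ≤ L) (h₂ : K₂ ≤ L) :
    K₁ ≤ K₂ ∨ K₂ ≤ K₁ := by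
  have hI : Complex.I ∉ L := fun hI => by
    obtain ⟨k, hk⟩ := exists_eq_cycField hI hL
    exact hnc ⟨2 ^ k, by positivity, hk⟩
  have hcyc (K : Subfield ℂ) (hK : K ≤ L) :
      ∃ k, Subfield.closure (insert Complex.I (K : Set ℂ)) = cycField (2 ^ k) := by
    refine exists_eq_cycField (n := n) (Subfield.subset_closure (Set.mem_insert _ _)) ?_
    refine Subfield.closure_le.2 (Set.insert_subset ?_ (hK.trans hL))
    refine Subfield.subset_closure ?_
    obtain ⟨c, rfl⟩ := Nat.exists_eq_add_of_le hn
    change Complex.I ^ _ = 1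
    rw [pow_add, pow_mul]
    norm_num
  have hle (K : Subfield ℂ) : K ≤ Subfield.closure (insert Complex.I (K : Set ℂ)) :=
    fun x hx => Subfield.subset_closure (Set.mem_insert_of_mem _ hx)
  obtain ⟨k₁, hk₁⟩ := hcyc K₁ h₁
  obtain ⟨k₂, hk₂⟩ := hcyc K₂ h₂
  rcases le_total k₁ k₂ with h | h
  · refine .inl (le_of_le_closure_insert_I hI h₁ h₂ ((hle K₁).trans ?_))
    rw [hk₁, hk₂]
    exact cycField_mono (pow_dvd_pow 2 h)
  · refine .inr (le_of_le_closure_insert_I hI h₂ h₁ ((hle K₂).trans ?_))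
    rw [hk₁, hk₂]
    exact cycField_mono (pow_dvd_pow 2 h)

lemma trace_mem_cycField {V : Type*} [AddCommGroup V] [Module ℂ V] [FiniteDimensional ℂ V]
    {f : End ℂ V} {m : ℕ} (hf : f ^ m = 1) : LinearMap.trace ℂ V f ∈ cycField m := by
  rw [Module.End.trace_eq_sum_roots_charpoly_of_splits (IsAlgClosed.splits _)]
  refine Subfield.multiset_sum_mem _ _ fun μ hμ => Subfield.subset_closure ?_
  have hev : f.HasEigenvalue μ :=
    (Module.End.hasEigenvalue_iff_isRoot_charpoly f μ).2 (Polynomial.isRoot_of_mem_roots hμ)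
  obtain ⟨v, hv⟩ := hev.exists_hasEigenvector
  have h := hv.pow_apply m
  rw [hf, Module.End.one_apply] at h
  exact (smul_left_injective ℂ hv.2 (by simpa using h)).symm

variable {G : Type} [Group G]

lemma character_mem_cycField (V : FDRep ℂ G) {g : G} {m : ℕ} (hg : g ^ m = 1) :
    V.character g ∈ cycField m :=
  trace_mem_cycField (by rw [← map_pow, hg, map_one])

/-- Schur's lemma: a group element acting centrally on an irreducible representation acts as a
scalar. -/
lemma exists_rho_eq_smul_one (V : FDRep ℂ G) [Simple V] {z : G}
    (hz : ∀ h : G, V.ρ z * V.ρ h = V.ρ h * V.ρ z) : ∃ c : ℂ, V.ρ z = c • 1 := by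
  let f : V ⟶ V := ⟨InducedCategory.homMk (ModuleCat.ofHom (V.ρ z)), fun h => by
    ext x
    exact LinearMap.congr_fun (hz h) x⟩
  obtain ⟨c, hc⟩ := endomorphism_simple_eq_smul_id ℂ f
  refine ⟨c, ?_⟩
  have := congrArg (fun k : V ⟶ V => k.hom.hom.hom) hc
  exact this.symm

lemma rho_eq_one_or_neg_one (V : FDRep ℂ G) [Simple V] {z : G}
    (hz : ∀ h : G, V.ρ z * V.ρ h = V.ρ h * V.ρ z) (hz2 : V.ρ (z ^ 2) = 1) :
    V.ρ z = 1 ∨ V.ρ z = -1 := by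
  obtain ⟨c, hc⟩ := exists_rho_eq_smul_one V hz
  rcases subsingleton_or_nontrivial V with hV | hV
  · exact .inl (Subsingleton.elim _ _)
  have h : c ^ 2 = 1 := by
    rw [map_pow, hc, smul_pow, one_pow] at hz2
    exact smul_left_injective ℂ (one_ne_zero (α := End ℂ V)) (by simpa using hz2)
  rcases eq_or_eq_neg_of_sq_eq_sq c 1 (by rwa [one_pow]) with rfl | rfl
  · exact .inl (by rw [hc, one_smul])
  · exact .inr (by rw [hc, neg_one_smul])

lemma simple_of_isIrreducible [Finite G] {V : Type} [AddCommGroup V] [Module ℂ V]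
    [FiniteDimensional ℂ V] (ρ : Representation ℂ G V) [ρ.IsIrreducible] :
    Simple (FDRep.of ρ) := by
  have := Fintype.ofFinite G
  rw [FDRep.simple_iff_char_is_norm_one]
  have h := Representation.char_orthonormal ρ ρ
  rw [if_pos ⟨Representation.Equiv.refl ρ⟩, inv_mul_eq_one₀ (by simp)] at h
  exact h.symm

lemma simple_trivial [Finite G] : Simple (FDRep.of (Representation.trivial ℂ G ℂ)) := by
  have := Fintype.ofFinite G
  rw [FDRep.simple_iff_char_is_norm_one]
  simp [FDRep.character]

lemma trace_eq_add_of_isCompl {V : Type*} [AddCommGroup V] [Module ℂ V] [FiniteDimensional ℂ V]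
    {p q : Submodule ℂ V} (h : IsCompl p q) {f : End ℂ V} (hp : ∀ x ∈ p, f x ∈ p)
    (hq : ∀ x ∈ q, f x ∈ q) :
    LinearMap.trace ℂ V f =
      LinearMap.trace ℂ p (f.restrict hp) + LinearMap.trace ℂ q (f.restrict hq) := by
  rw [← LinearMap.trace_prodMap', ← LinearMap.trace_conj' _ (p.prodEquivOfIsCompl q h)]
  congr 1
  ext x
  obtain ⟨y, rfl⟩ := (p.prodEquivOfIsCompl q h).surjective x
  simp [LinearEquiv.conj_apply]

/-- A character trivial on `N` is a sum of irreducible characters trivial on `N`. -/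
lemma character_mem_of_simple [Finite G] {g : G} {N : Subgroup G} {F : Subfield ℂ}
    (hF : ∀ V : FDRep ℂ G, Simple V → N ≤ V.ρ.ker → V.character g ∈ F)
    {V : Type} [AddCommGroup V] [Module ℂ V] [FiniteDimensional ℂ V]
    (ρ : Representation ℂ G V) (hρ : ∀ n ∈ N, ρ n = 1) : ρ.character g ∈ F := by
  induction hd : finrank ℂ V using Nat.strong_induction_on generalizing V with
  | _ d ih =>
  subst hd
  by_cases hirr : ρ.IsIrreducible
  · exact hF _ (simple_of_isIrreducible ρ) hρ
  rcases subsingleton_or_nontrivial V with hV | hV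
  · have : ρ g = 0 := Subsingleton.elim _ _
    simp [Representation.character, this]
  obtain ⟨p, hp0, hp1⟩ : ∃ p : Subrepresentation ρ, p ≠ ⊥ ∧ p ≠ ⊤ := by
    by_contra! h
    refine hirr { exists_pair_ne := ⟨⊥, ⊤, fun h' => ?_⟩,
                  eq_bot_or_eq_top := fun p => or_iff_not_imp_left.2 (h p) }
    exact bot_ne_top (congrArg Subrepresentation.toSubmodule h')
  obtain ⟨q, hpq⟩ := exists_isCompl p
  have hc : IsCompl p.toSubmodule q.toSubmodule :=
    ⟨disjoint_iff.2 (congrArg Subrepresentation.toSubmodule hpq.inf_eq_bot),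
      codisjoint_iff.2 (congrArg Subrepresentation.toSubmodule hpq.sup_eq_top)⟩
  have hlt (r : Subrepresentation ρ) (hr : r ≠ ⊤) : finrank ℂ r.toSubmodule < finrank ℂ V :=
    Submodule.finrank_lt fun h => hr (Subrepresentation.toSubmodule_injective h)
  have hq1 : q ≠ ⊤ := fun h => hp0 (by simpa [h] using hpq.inf_eq_bot)
  have htriv (r : Subrepresentation ρ) : ∀ n ∈ N, r.toRepresentation n = 1 := fun n hn => by
    ext x
    simp [Subrepresentation.toRepresentation, hρ n hn]
  have : ρ.character g = p.toRepresentation.character g + q.toRepresentation.character g :=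
    trace_eq_add_of_isCompl hc (p.apply_mem_toSubmodule g) (q.apply_mem_toSubmodule g)
  rw [this]
  exact add_mem (ih _ (hlt p hp1) _ (htriv p) rfl) (ih _ (hlt q hq1) _ (htriv q) rfl)

lemma char_mul_char_mem [Finite G] {g z : G} {M N : Subgroup G} {F : Subfield ℂ}
    (hM : M = N ⊔ Subgroup.zpowers z)
    (hF : ∀ V : FDRep ℂ G, Simple V → M ≤ V.ρ.ker → V.character g ∈ F)
    (V W : FDRep ℂ G) (hV : N ≤ V.ρ.ker) (hW : N ≤ W.ρ.ker)
    (hVz : V.ρ z = -1) (hWz : W.ρ z = -1) :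
    V.character g * W.character g ∈ F := by
  let τ := Representation.tprod V.ρ W.ρ
  have hτ : M ≤ τ.ker := by
    rw [hM, sup_le_iff, Subgroup.zpowers_le]
    constructor
    · intro n hn
      have h1 : V.ρ n = 1 := hV hn
      have h2 : W.ρ n = 1 := hW hn
      change τ n = 1
      simp [τ, h1, h2]
    · change τ z = 1
      ext x y
      simp [τ, hVz, hWz, TensorProduct.neg_tmul, TensorProduct.tmul_neg]
  have h := character_mem_of_simple hF τ fun n hn => hτ hn
  rwa [Representation.char_tensor] at h

lemma exists_central_extension [Finite G] (hG : IsPGroup 2 G) {N : Subgroup G} [N.Normal]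
    (hN : N ≠ ⊤) : ∃ z : G, (∀ h, z * h * z⁻¹ * h⁻¹ ∈ N) ∧ z ^ 2 ∈ N ∧ z ∉ N := by
  have hQ : IsPGroup 2 (G ⧸ N) := hG.to_quotient N
  have : Nontrivial (G ⧸ N) := QuotientGroup.nontrivial_iff.2 hN
  have hc := hQ.center_nontrivial
  obtain ⟨k, hk0, hk⟩ := (hQ.to_subgroup (Subgroup.center (G ⧸ N))).nontrivial_iff_card.1 hc
  obtain ⟨c, hc⟩ := exists_prime_orderOf_dvd_card' (G := Subgroup.center (G ⧸ N)) 2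
    (hk ▸ dvd_pow_self 2 hk0.ne')
  obtain ⟨z, hz⟩ := QuotientGroup.mk_surjective (c : G ⧸ N)
  refine ⟨z, fun h => ?_, ?_, fun hzN => ?_⟩
  · rw [← QuotientGroup.eq_one_iff]
    have := Subgroup.mem_center_iff.1 c.2 (h : G ⧸ N)
    rw [← hz] at this
    simp only [QuotientGroup.mk_mul, QuotientGroup.mk_inv, ← this]
    group
  · rw [← QuotientGroup.eq_one_iff, QuotientGroup.mk_pow, hz]
    have := pow_orderOf_eq_one c
    rw [hc] at this
    exact_mod_cast congrArg Subtype.val this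
  · rw [← QuotientGroup.eq_one_iff, hz] at hzN
    have : c = 1 := Subtype.ext hzN
    simp [this] at hc

lemma normal_sup_zpowers {N : Subgroup G} [N.Normal] {z : G} (hz : ∀ h, z * h * z⁻¹ * h⁻¹ ∈ N) :
    (N ⊔ Subgroup.zpowers z).Normal := by
  refine ⟨fun m hm h => ?_⟩
  suffices N ⊔ Subgroup.zpowers z ≤
      (N ⊔ Subgroup.zpowers z).comap (MulAut.conj h).toMonoidHom from this hm
  rw [sup_le_iff, Subgroup.zpowers_le]
  refine ⟨fun n hn => Subgroup.mem_sup_left (Subgroup.Normal.conj_mem inferInstance n hn h), ?_⟩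
  change h * z * h⁻¹ ∈ N ⊔ Subgroup.zpowers z
  rw [show h * z * h⁻¹ = h * (z * h⁻¹ * z⁻¹ * h⁻¹⁻¹) * h⁻¹ * z by group]
  exact mul_mem (Subgroup.mem_sup_left (Subgroup.Normal.conj_mem inferInstance _ (hz _) h))
    (Subgroup.mem_sup_right (Subgroup.mem_zpowers z))

lemma character_mem_bot_of_top_le_ker (V : FDRep ℂ G) (hV : ⊤ ≤ V.ρ.ker) (g : G) :
    V.character g ∈ (⊥ : Subfield ℂ) := by
  have : V.ρ g = 1 := hV (Subgroup.mem_top g)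
  rw [FDRep.character, this, LinearMap.trace_one]
  exact natCast_mem _ _

/-- The field generated by the values at `g` of the irreducible characters trivial on `N`. -/
noncomputable def charFieldAtOver (g : G) (N : Subgroup G) : Subfield ℂ :=
  Subfield.closure {x | ∃ V : FDRep ℂ G, Simple V ∧ N ≤ V.ρ.ker ∧ V.character g = x}

lemma character_mem_charFieldAtOver {g : G} {N : Subgroup G} (V : FDRep ℂ G) (hV : Simple V)
    (hN : N ≤ V.ρ.ker) : V.character g ∈ charFieldAtOver g N :=
  Subfield.subset_closure ⟨V, hV, hN, rfl⟩

lemma charFieldAtOver_anti (g : G) {N M : Subgroup G} (h : N ≤ M) :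
    charFieldAtOver g M ≤ charFieldAtOver g N :=
  Subfield.closure_mono fun _ ⟨V, hV, hM, hx⟩ => ⟨V, hV, h.trans hM, hx⟩

lemma charFieldAtOver_le_closure_insert [Finite G] {g z : G} {N : Subgroup G}
    (hz : ∀ h, z * h * z⁻¹ * h⁻¹ ∈ N) (hz2 : z ^ 2 ∈ N) (V : FDRep ℂ G) (hV : Simple V)
    (hVN : N ≤ V.ρ.ker)
    (hVM : V.character g ∉ charFieldAtOver g (N ⊔ Subgroup.zpowers z)) :
    V.character g ^ 2 ∈ charFieldAtOver g (N ⊔ Subgroup.zpowers z) ∧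
    charFieldAtOver g N ≤ Subfield.closure
      (insert (V.character g) (charFieldAtOver g (N ⊔ Subgroup.zpowers z) : Set ℂ)) := by
  set F := charFieldAtOver g (N ⊔ Subgroup.zpowers z)
  have hsign (W : FDRep ℂ G) (hW : Simple W) (hWN : N ≤ W.ρ.ker) :
      W.character g ∈ F ∨ W.ρ z = -1 := by
    have hcomm (h : G) : W.ρ z * W.ρ h = W.ρ h * W.ρ z := by
      have h1 : W.ρ (z * h * z⁻¹ * h⁻¹) = 1 := hWN (hz h)
      rw [← map_mul, ← map_mul, show z * h = z * h * z⁻¹ * h⁻¹ * (h * z) by group, map_mul, h1,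
        one_mul]
    refine (rho_eq_one_or_neg_one W hcomm (hWN hz2)).imp_left fun h => ?_
    refine character_mem_charFieldAtOver W hW ?_
    rw [sup_le_iff, Subgroup.zpowers_le]
    exact ⟨hWN, h⟩
  have hmul (W : FDRep ℂ G) (hWN : N ≤ W.ρ.ker) (hWz : W.ρ z = -1) :
      W.character g * V.character g ∈ F :=
    char_mul_char_mem rfl (fun U hU hUM => character_mem_charFieldAtOver U hU hUM) W V hWN hVN hWz
      ((hsign V hV hVN).resolve_left hVM)
  have hx0 : V.character g ≠ 0 := fun h => hVM (h ▸ zero_mem F)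
  have hx2 : V.character g ^ 2 ∈ F := by
    rw [pow_two]
    exact hmul V hVN ((hsign V hV hVN).resolve_left hVM)
  refine ⟨hx2, Subfield.closure_le.2 ?_⟩
  rintro _ ⟨W, hW, hWN, rfl⟩
  have hFle : F ≤ Subfield.closure (insert (V.character g) (F : Set ℂ)) :=
    fun x hx => Subfield.subset_closure (Set.mem_insert_of_mem _ hx)
  rcases hsign W hW hWN with h | h
  · exact hFle h
  · have h1 := div_mem (hFle (hmul W hWN h))
      (Subfield.subset_closure (Set.mem_insert (V.character g) (F : Set ℂ)))
    rwa [mul_div_cancel_right₀ _ hx0] at h1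

lemma exists_eq_closure_character [Finite G] (hG : IsPGroup 2 G) (g : G) (N : Subgroup G)
    (hnormal : N.Normal) (htot : ∀ K₁ K₂ : Subfield ℂ, K₁ ≤ charFieldAtOver g N →
      K₂ ≤ charFieldAtOver g N → K₁ ≤ K₂ ∨ K₂ ≤ K₁) {K : Subfield ℂ}
    (hK : K ≤ charFieldAtOver g N) :
    ∃ V : FDRep ℂ G, Simple V ∧ N ≤ V.ρ.ker ∧ K = Subfield.closure {V.character g} := by
  induction N using WellFoundedGT.induction with
  | _ N ih =>
  by_cases hN : N = ⊤
  · subst hN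
    have hker : ⊤ ≤ (FDRep.of (Representation.trivial ℂ G ℂ)).ρ.ker := fun _ _ => rfl
    refine ⟨_, simple_trivial, hker, ?_⟩
    have hbot : charFieldAtOver g ⊤ ≤ ⊥ := Subfield.closure_le.2 fun _ ⟨V, _, hV, hx⟩ =>
      hx ▸ character_mem_bot_of_top_le_ker V hV g
    rw [le_bot_iff.1 (hK.trans hbot)]
    refine (le_bot_iff.1 (Subfield.closure_le.2 (Set.singleton_subset_iff.2 ?_))).symm
    exact character_mem_bot_of_top_le_ker _ hker g
  obtain ⟨z, hz, hz2, hzN⟩ := exists_central_extension hG hN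
  set M := N ⊔ Subgroup.zpowers z
  have hNM : N < M := lt_of_le_of_ne le_sup_left fun h =>
    hzN (h ▸ Subgroup.mem_sup_right (Subgroup.mem_zpowers z))
  have hMN := charFieldAtOver_anti g hNM.le
  have ih' (hKM : K ≤ charFieldAtOver g M) :
      ∃ V : FDRep ℂ G, Simple V ∧ N ≤ V.ρ.ker ∧ K = Subfield.closure {V.character g} := by
    obtain ⟨V, hV, hVM, hKV⟩ := ih M hNM (normal_sup_zpowers hz)
      (fun K₁ K₂ h₁ h₂ => htot K₁ K₂ (h₁.trans hMN) (h₂.trans hMN)) hKM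
    exact ⟨V, hV, hNM.le.trans hVM, hKV⟩
  by_cases hall : charFieldAtOver g N ≤ charFieldAtOver g M
  · exact ih' (hK.trans hall)
  obtain ⟨V, hV, hVN, hVM⟩ : ∃ V : FDRep ℂ G, Simple V ∧ N ≤ V.ρ.ker ∧
      V.character g ∉ charFieldAtOver g M := by
    by_contra! h
    exact hall (Subfield.closure_le.2 fun _ ⟨V, hV, hVN, hx⟩ => hx ▸ h V hV hVN)
  obtain ⟨hx2, hle⟩ := charFieldAtOver_le_closure_insert hz hz2 V hV hVN hVM
  have hVle (L : Subfield ℂ) : Subfield.closure {V.character g} ≤ L ↔ V.character g ∈ L :=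
    Subfield.closure_le.trans Set.singleton_subset_iff
  have hV_le : Subfield.closure {V.character g} ≤ charFieldAtOver g N :=
    (hVle _).2 (character_mem_charFieldAtOver V hV hVN)
  have hMV : charFieldAtOver g M ≤ Subfield.closure {V.character g} :=
    (htot _ _ hMN hV_le).resolve_right fun h => hVM ((hVle _).1 h)
  have hNV : charFieldAtOver g N ≤ Subfield.closure {V.character g} :=
    hle.trans (Subfield.closure_le.2 (Set.insert_subset ((hVle _).1 le_rfl) hMV))
  rcases htot K _ hK hMN with h | h
  · exact ih' h
  rcases le_or_mem_of_le_closure_insert hx2 h (hK.trans hle) with h' | h'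
  · exact ih' h'
  · exact ⟨V, hV, hVN, le_antisymm (hK.trans hNV) ((hVle K).2 h')⟩

/-- If `G` is a finite 2-group and `g ∈ G` is such that `ℚ(g)` is not
a cyclotomic field, then every subfield of `ℚ(g)` equals `ℚ(χ(g))` for some irreducible
character `χ` of `G`. -/
theorem subfield_eq_adjoin_character_value (G : Type) [Group G] [Finite G]
    (hG : IsPGroup 2 G) (g : G)
    (hnc : ¬ ∃ m : ℕ, 0 < m ∧ charFieldAt g = cycField m) :
    ∀ K : Subfield ℂ, K ≤ charFieldAt g →
      ∃ V : FDRep ℂ G, Simple V ∧ K = Subfield.closure {V.character g} := by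
  have hF : charFieldAt g = charFieldAtOver g ⊥ := by
    simp [charFieldAt, charFieldAtOver, charValuesAt]
  obtain ⟨n, hn⟩ := hG g
  have hg : g ^ 2 ^ (n + 2) = 1 := by rw [pow_add, pow_mul, hn, one_pow]
  have hle : charFieldAt g ≤ cycField (2 ^ (n + 2)) := Subfield.closure_le.2 fun _ ⟨V, _, hx⟩ =>
    hx ▸ character_mem_cycField V hg
  intro K hK
  obtain ⟨V, hV, -, hKV⟩ := exists_eq_closure_character hG g ⊥ inferInstance
    (fun K₁ K₂ h₁ h₂ => subfields_total_of_not_cyclotomic (by omega) hle hnc (hF ▸ h₁) (hF ▸ h₂))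
    (hF ▸ hK)
  exact ⟨V, hV, hKV⟩
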